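/- arXiv:0709.1034 — 2 statements merged into one kernel-verified Lean document; each statement's English description precedes it below -/
import Mathlib

section
/- Let m > 0, b > 0, s ∈ {−1, +1} and 0 < ε < m, and for z ∈ ℝ³ \ {0} define E_s(z) := −(1/√π) ∫₀^∞ τ^{−1/2} · (d/dτ)[ e^{−τm²} e^{sbτ} N_b(τ,z) ] dτ. Then there exists a constant C > 0 (depending on m, b and ε) such that |E_s(z)| ≤ C · |z|^{−4} · e^{−(m−ε)|z|} for all z ≠ 0. -/
open Real MeasureTheory

/-- The hyperbolic cotangent `coth z = cosh z / sinh z`. -/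
noncomputable def coth (z : ℝ) : ℝ := Real.cosh z / Real.sinh z

/-- The phase-free Mehler heat kernel `N_b(τ,z)` for a constant magnetic field of
strength `b`. -/
noncomputable def mehlerN (b τ : ℝ) (z : EuclideanSpace ℝ (Fin 3)) : ℝ :=
  (4 * π * τ) ^ (-(1 : ℝ) / 2) * (b / (4 * π * Real.sinh (b * τ))) *
    Real.exp (-(z 2) ^ 2 / (4 * τ)) *
    Real.exp (-(b / 4) * coth (b * τ) * ((z 0) ^ 2 + (z 1) ^ 2))

/-- The kernel `E_s(z) = -(1/√π) ∫₀^∞ τ^{-1/2} (d/dτ)[e^{-τm²} e^{sbτ} N_b(τ,z)] dτ` of the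
pseudorelativistic kinetic energy operator `E_A = |α(p - eA) + βm|` (up to a phase). -/
noncomputable def kinKernel (m b s : ℝ) (z : EuclideanSpace ℝ (Fin 3)) : ℝ :=
  -(1 / Real.sqrt π) * ∫ τ in Set.Ioi (0 : ℝ),
    τ ^ (-(1 : ℝ) / 2) *
      deriv (fun σ : ℝ => Real.exp (-σ * m ^ 2) * Real.exp (s * b * σ) * mehlerN b σ z) τ

lemma aux_poly (n : ℕ) (hn : 0 < n) (a : ℝ) (ha : 0 < a) :
    ∃ K : ℝ, 0 < K ∧ ∀ x : ℝ, 0 ≤ x → (1 + x) ^ n * Real.exp (-(a * x)) ≤ K := by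
  have hn' : (0 : ℝ) < n := by exact_mod_cast hn
  refine ⟨(1 + n / a) ^ n, by positivity, fun x hx => ?_⟩
  have h1 : 1 + x ≤ (1 + n / a) * Real.exp (a / n * x) := by
    have h2 := Real.add_one_le_exp (a / n * x)
    calc 1 + x ≤ (1 + n / a) * (a / n * x + 1) := by
          have : (1 + n / a) * (a / n * x + 1) = 1 + x + (a / n * x + n / a) := by
            field_simp
            ring
          rw [this]
          have : 0 ≤ a / n * x + n / a := by positivity
          linarith
      _ ≤ _ := by gcongr
  have h3 : (1 + x) ^ n ≤ ((1 + n / a) * Real.exp (a / n * x)) ^ n := by gcongr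
  have h4 : ((1 + n / a) * Real.exp (a / n * x)) ^ n = (1 + n / a) ^ n * Real.exp (a * x) := by
    rw [mul_pow, ← Real.exp_nat_mul]
    congr 2
    field_simp
  rw [h4] at h3
  calc (1 + x) ^ n * Real.exp (-(a * x)) ≤ (1 + n / a) ^ n * Real.exp (a * x) * Real.exp (-(a * x)) := by
        gcongr
    _ = (1 + n / a) ^ n := by rw [mul_assoc, ← Real.exp_add]; simp

lemma aux_coth_ge (x : ℝ) (hx : 0 < x) : Real.sinh x ≤ x * Real.cosh x := by
  have hm : MonotoneOn (fun y : ℝ => y * Real.cosh y - Real.sinh y) (Set.Ici 0) := by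
    apply monotoneOn_of_deriv_nonneg (convex_Ici 0)
    · exact Continuous.continuousOn (by fun_prop)
    · exact Differentiable.differentiableOn (by fun_prop)
    · intro y hy
      rw [interior_Ici] at hy
      have : HasDerivAt (fun y : ℝ => y * Real.cosh y - Real.sinh y)
          (1 * Real.cosh y + y * Real.sinh y - Real.cosh y) y :=
        ((hasDerivAt_id y).mul (Real.hasDerivAt_cosh y)).sub (Real.hasDerivAt_sinh y)
      rw [this.deriv]
      have hy' : 0 < y := hy
      have := Real.sinh_pos_iff.2 hy'
      nlinarith
  have := hm (Set.mem_Ici.2 le_rfl) (Set.mem_Ici.2 hx.le) hx.le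
  simp at this
  linarith

lemma aux_cosh_le (x : ℝ) (hx : 0 < x) : x * Real.cosh x ≤ (x + 1) * Real.sinh x := by
  have h1 : Real.cosh x - Real.sinh x = Real.exp (-x) := Real.cosh_sub_sinh x
  have h2 : Real.exp (-x) ≤ 1 := Real.exp_le_one_iff.2 (by linarith)
  have h3 : x ≤ Real.sinh x := Real.self_le_sinh_iff.2 hx.le
  nlinarith

lemma aux_exp_le (x : ℝ) (hx : 0 < x) : x * Real.exp x ≤ (2 * x + 1) * Real.sinh x := by
  have h1 := Real.cosh_add_sinh x
  have := aux_cosh_le x hx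
  nlinarith

lemma aux_deriv (m b s τ : ℝ) (z : EuclideanSpace ℝ (Fin 3)) (hb : 0 < b) (hτ : 0 < τ) :
    HasDerivAt (fun σ : ℝ => Real.exp (-σ * m ^ 2) * Real.exp (s * b * σ) * mehlerN b σ z)
      (Real.exp (-τ * m ^ 2) * Real.exp (s * b * τ) * mehlerN b τ z *
        (-m ^ 2 + s * b - 1 / (2 * τ) - b * coth (b * τ) + (z 2) ^ 2 / (4 * τ ^ 2)
          + (b ^ 2 / (4 * Real.sinh (b * τ) ^ 2)) * ((z 0) ^ 2 + (z 1) ^ 2))) τ := by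
  have hS : 0 < Real.sinh (b * τ) := Real.sinh_pos_iff.2 (by positivity)
  have hbτ : HasDerivAt (fun σ : ℝ => b * σ) b τ := by
    simpa using (hasDerivAt_id τ).const_mul b
  have e1 : HasDerivAt (fun σ : ℝ => Real.exp (-σ * m ^ 2)) (Real.exp (-τ * m ^ 2) * (-1 * m ^ 2)) τ :=
    ((hasDerivAt_id τ).neg.mul_const (m ^ 2)).exp
  have e2 : HasDerivAt (fun σ : ℝ => Real.exp (s * b * σ)) (Real.exp (s * b * τ) * (s * b * 1)) τ :=
    ((hasDerivAt_id τ).const_mul (s * b)).exp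
  have e3 : HasDerivAt (fun σ : ℝ => (4 * π * σ) ^ (-(1 : ℝ) / 2))
      ((4 * π * τ) ^ (-(1 : ℝ) / 2) * (-1 / (2 * τ))) τ := by
    have hne : 4 * π * τ ≠ 0 := by positivity
    have := ((hasDerivAt_id τ).const_mul (4 * π)).rpow_const (p := -(1 : ℝ) / 2) (Or.inl hne)
    refine HasDerivAt.congr_deriv this ?_
    rw [show (4 * π * id τ) = 4 * π * τ from rfl, Real.rpow_sub_one hne]
    field_simp
  have hs : HasDerivAt (fun σ : ℝ => Real.sinh (b * σ)) (Real.cosh (b * τ) * b) τ := hbτ.sinh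
  have hc : HasDerivAt (fun σ : ℝ => Real.cosh (b * σ)) (Real.sinh (b * τ) * b) τ := hbτ.cosh
  have e4 : HasDerivAt (fun σ : ℝ => b / (4 * π * Real.sinh (b * σ)))
      (b / (4 * π * Real.sinh (b * τ)) * (-(b * coth (b * τ)))) τ := by
    have := (hasDerivAt_const τ b).div (hs.const_mul (4 * π)) (by positivity)
    refine HasDerivAt.congr_deriv this ?_
    unfold coth
    field_simp
    ring
  have e5 : HasDerivAt (fun σ : ℝ => Real.exp (-(z 2) ^ 2 / (4 * σ)))
      (Real.exp (-(z 2) ^ 2 / (4 * τ)) * ((z 2) ^ 2 / (4 * τ ^ 2))) τ := by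
    have h := (hasDerivAt_const τ (-(z 2) ^ 2)).div ((hasDerivAt_id τ).const_mul 4)
      (by simp; positivity)
    refine HasDerivAt.congr_deriv h.exp ?_
    simp only [id, Pi.div_apply]
    congr 1
    field_simp
    ring
  have e6 : HasDerivAt (fun σ : ℝ => Real.exp (-(b / 4) * coth (b * σ) * ((z 0) ^ 2 + (z 1) ^ 2)))
      (Real.exp (-(b / 4) * coth (b * τ) * ((z 0) ^ 2 + (z 1) ^ 2)) *
        ((b ^ 2 / (4 * Real.sinh (b * τ) ^ 2)) * ((z 0) ^ 2 + (z 1) ^ 2))) τ := by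
    have h := (((hc.div hs hS.ne').const_mul (-(b / 4))).mul_const ((z 0) ^ 2 + (z 1) ^ 2)).exp
    refine HasDerivAt.congr_deriv h ?_
    unfold coth
    simp only [Pi.div_apply]
    congr 1
    have := Real.cosh_sq (b * τ)
    field_simp
    rw [this]
    ring
  have h := (e1.mul e2).mul (((e3.mul e4).mul e5).mul e6)
  refine HasDerivAt.congr_deriv h ?_
  simp only [Pi.mul_apply]
  unfold mehlerN
  ring

lemma aux_bound (m b s τ : ℝ) (z : EuclideanSpace ℝ (Fin 3)) (hb : 0 < b) (hτ : 0 < τ)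
    (hs : s = -1 ∨ s = 1) :
    |τ ^ (-(1 : ℝ) / 2) *
      deriv (fun σ : ℝ => Real.exp (-σ * m ^ 2) * Real.exp (s * b * σ) * mehlerN b σ z) τ| ≤
    τ⁻¹ * (2 * b + 1 / τ) * (m ^ 2 + 2 * b + 3 / (2 * τ) + ‖z‖ ^ 2 / (4 * τ ^ 2)) *
      Real.exp (-(τ * m ^ 2 + ‖z‖ ^ 2 / (4 * τ))) := by
  have hx : 0 < b * τ := by positivity
  have hS : 0 < Real.sinh (b * τ) := Real.sinh_pos_iff.2 hx
  have hz : ‖z‖ ^ 2 = (z 0) ^ 2 + (z 1) ^ 2 + (z 2) ^ 2 := by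
    rw [EuclideanSpace.norm_sq_eq, Fin.sum_univ_three]
    simp
  have hcoth1 : 1 / (b * τ) ≤ coth (b * τ) := by
    unfold coth
    rw [div_le_div_iff₀ hx hS]
    linarith [aux_coth_ge _ hx]
  have hcoth2 : b * coth (b * τ) ≤ b + 1 / τ := by
    have : coth (b * τ) ≤ (b * τ + 1) / (b * τ) := by
      unfold coth
      rw [div_le_div_iff₀ hS hx]
      linarith [aux_cosh_le _ hx]
    calc b * coth (b * τ) ≤ b * ((b * τ + 1) / (b * τ)) := by gcongr
      _ = b + 1 / τ := by field_simp
  have hcoth0 : 0 ≤ b * coth (b * τ) := by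
    have : 0 ≤ coth (b * τ) := le_trans (by positivity) hcoth1
    positivity
  have hsb : |s * b| = b := by
    rcases hs with h | h <;> simp [h, abs_of_pos hb]
  have hs2 : b ^ 2 / (4 * Real.sinh (b * τ) ^ 2) ≤ 1 / (4 * τ ^ 2) := by
    have h1 : b * τ ≤ Real.sinh (b * τ) := Real.self_le_sinh_iff.2 hx.le
    calc b ^ 2 / (4 * Real.sinh (b * τ) ^ 2) ≤ b ^ 2 / (4 * (b * τ) ^ 2) := by gcongr
      _ = _ := by field_simp
  have hL : |(-m ^ 2 + s * b - 1 / (2 * τ) - b * coth (b * τ) + (z 2) ^ 2 / (4 * τ ^ 2)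
          + (b ^ 2 / (4 * Real.sinh (b * τ) ^ 2)) * ((z 0) ^ 2 + (z 1) ^ 2))| ≤
      m ^ 2 + 2 * b + 3 / (2 * τ) + ‖z‖ ^ 2 / (4 * τ ^ 2) := by
    have hsb1 := abs_le.1 hsb.le
    have h1 : (b ^ 2 / (4 * Real.sinh (b * τ) ^ 2)) * ((z 0) ^ 2 + (z 1) ^ 2) ≤
      1 / (4 * τ ^ 2) * ((z 0) ^ 2 + (z 1) ^ 2) := by gcongr
    have h2 : 0 ≤ (b ^ 2 / (4 * Real.sinh (b * τ) ^ 2)) * ((z 0) ^ 2 + (z 1) ^ 2) := by positivity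
    have h3 : ‖z‖ ^ 2 / (4 * τ ^ 2) =
      (z 2) ^ 2 / (4 * τ ^ 2) + 1 / (4 * τ ^ 2) * ((z 0) ^ 2 + (z 1) ^ 2) := by rw [hz]; ring
    have h4 : 3 / (2 * τ) = 1 / (2 * τ) + 1 / τ := by field_simp; ring
    have h5 : 0 ≤ 1 / (2 * τ) := by positivity
    have h6 : 0 ≤ 1 / τ := by positivity
    have h7 : 0 ≤ (z 2) ^ 2 / (4 * τ ^ 2) := by positivity
    have h8 := sq_nonneg m
    rw [h3, h4, abs_le]
    constructor <;> linarith [hsb1.1, hsb1.2]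
  have hF0 : 0 ≤ τ ^ (-(1 : ℝ) / 2) * (Real.exp (-τ * m ^ 2) * Real.exp (s * b * τ) * mehlerN b τ z) := by
    unfold mehlerN
    positivity
  have hF : τ ^ (-(1 : ℝ) / 2) * (Real.exp (-τ * m ^ 2) * Real.exp (s * b * τ) * mehlerN b τ z) ≤
      τ⁻¹ * (2 * b + 1 / τ) * Real.exp (-(τ * m ^ 2 + ‖z‖ ^ 2 / (4 * τ))) := by
    have a1 : τ ^ (-(1 : ℝ) / 2) * (4 * π * τ) ^ (-(1 : ℝ) / 2) ≤ τ⁻¹ := by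
      have h : (4 * π * τ) ^ (-(1 : ℝ) / 2) ≤ τ ^ (-(1 : ℝ) / 2) := by
        apply Real.rpow_le_rpow_of_nonpos hτ
        · nlinarith [Real.pi_gt_three]
        · norm_num
      calc _ ≤ τ ^ (-(1 : ℝ) / 2) * τ ^ (-(1 : ℝ) / 2) := by gcongr
        _ = τ⁻¹ := by
          rw [← Real.rpow_add hτ, ← Real.rpow_neg_one]
          norm_num
    have a2 : Real.exp (s * b * τ) * (b / (4 * π * Real.sinh (b * τ))) ≤ 2 * b + 1 / τ := by
      have h1 : Real.exp (s * b * τ) ≤ Real.exp (b * τ) := by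
        apply Real.exp_le_exp.2
        have := (abs_le.1 hsb.le).2
        gcongr
      have h2 : b / (4 * π * Real.sinh (b * τ)) ≤ b / Real.sinh (b * τ) := by
        gcongr
        nlinarith [Real.pi_gt_three]
      calc _ ≤ Real.exp (b * τ) * (b / Real.sinh (b * τ)) := by gcongr
        _ = (b * τ * Real.exp (b * τ)) / (τ * Real.sinh (b * τ)) := by field_simp
        _ ≤ ((2 * (b * τ) + 1) * Real.sinh (b * τ)) / (τ * Real.sinh (b * τ)) := by
          gcongr ?_ / _
          exact aux_exp_le _ hx
        _ = _ := by field_simp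
    have a3 : Real.exp (-τ * m ^ 2) * (Real.exp (-(z 2) ^ 2 / (4 * τ)) *
        Real.exp (-(b / 4) * coth (b * τ) * ((z 0) ^ 2 + (z 1) ^ 2))) ≤
        Real.exp (-(τ * m ^ 2 + ‖z‖ ^ 2 / (4 * τ))) := by
      rw [← Real.exp_add, ← Real.exp_add]
      apply Real.exp_le_exp.2
      have h1 : b / 4 * (1 / (b * τ)) * ((z 0) ^ 2 + (z 1) ^ 2) ≤
        b / 4 * coth (b * τ) * ((z 0) ^ 2 + (z 1) ^ 2) := by gcongr
      have h2 : ‖z‖ ^ 2 / (4 * τ) = (z 2) ^ 2 / (4 * τ) +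
        b / 4 * (1 / (b * τ)) * ((z 0) ^ 2 + (z 1) ^ 2) := by
        rw [hz]; field_simp; ring
      rw [h2, neg_div]
      linarith
    calc _ = (τ ^ (-(1 : ℝ) / 2) * (4 * π * τ) ^ (-(1 : ℝ) / 2)) *
          (Real.exp (s * b * τ) * (b / (4 * π * Real.sinh (b * τ)))) *
          (Real.exp (-τ * m ^ 2) * (Real.exp (-(z 2) ^ 2 / (4 * τ)) *
        Real.exp (-(b / 4) * coth (b * τ) * ((z 0) ^ 2 + (z 1) ^ 2)))) := by
          unfold mehlerN; ring
      _ ≤ _ := by gcongr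
  rw [(aux_deriv m b s τ z hb hτ).deriv, ← mul_assoc, abs_mul, abs_of_nonneg hF0]
  calc _ ≤ (τ⁻¹ * (2 * b + 1 / τ) * Real.exp (-(τ * m ^ 2 + ‖z‖ ^ 2 / (4 * τ)))) *
      (m ^ 2 + 2 * b + 3 / (2 * τ) + ‖z‖ ^ 2 / (4 * τ ^ 2)) := by gcongr
    _ = _ := by ring

lemma aux_final (m b ε : ℝ) (hm : 0 < m) (hb : 0 < b) (hε : 0 < ε) (hεm : ε < m) :
    ∃ K : ℝ, 0 < K ∧ ∀ τ r : ℝ, 0 < τ → 0 < r →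
      τ⁻¹ * (2 * b + 1 / τ) * (m ^ 2 + 2 * b + 3 / (2 * τ) + r ^ 2 / (4 * τ ^ 2)) *
      Real.exp (-(τ * m ^ 2 + r ^ 2 / (4 * τ))) ≤
      (K / r ^ 6 * Real.exp (-(m - ε) * r)) * (1 + (τ / r ^ 2) ^ 2)⁻¹ := by
  obtain ⟨K1, hK1, h1⟩ := aux_poly 2 (by norm_num) (ε / m * m ^ 2) (by positivity)
  obtain ⟨K2, hK2, h2⟩ := aux_poly 4 (by norm_num) (ε / m / 4) (by positivity)
  refine ⟨(2 * b + 1) * (m ^ 2 + 2 * b + 2) * K1 * K2, by positivity, fun τ r hτ hr => ?_⟩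
  obtain ⟨y, hy⟩ : ∃ y, y = r ^ 2 / τ := ⟨_, rfl⟩
  have hy0 : 0 < y := by rw [hy]; positivity
  have g1 := h1 τ hτ.le
  have g2 := h2 y hy0.le
  have hexp : Real.exp (-(τ * m ^ 2 + r ^ 2 / (4 * τ))) ≤ Real.exp (-(m - ε) * r) *
      (Real.exp (-(ε / m * m ^ 2 * τ)) * Real.exp (-(ε / m / 4 * y))) := by
    rw [← Real.exp_add, ← Real.exp_add]
    apply Real.exp_le_exp.2
    have k1 : m * r ≤ τ * m ^ 2 + r ^ 2 / (4 * τ) := by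
      have : τ * m ^ 2 + r ^ 2 / (4 * τ) - m * r = (2 * τ * m - r) ^ 2 / (4 * τ) := by
        field_simp; ring
      have h : 0 ≤ (2 * τ * m - r) ^ 2 / (4 * τ) := by positivity
      linarith
    have k2 : 0 ≤ 1 - ε / m := by
      rw [sub_nonneg, div_le_one hm]; exact hεm.le
    have k3 := mul_le_mul_of_nonneg_left k1 k2
    have k4 : (1 - ε / m) * (m * r) = (m - ε) * r := by field_simp
    have k5 : ε / m / 4 * y = ε / m * (r ^ 2 / (4 * τ)) := by rw [hy]; field_simp
    rw [k5]
    linarith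
  have hr2 : r ^ 2 = y * τ := by rw [hy]; field_simp
  have hr6 : r ^ 6 = (y * τ) ^ 3 := by rw [← hr2]; ring
  have hpoly : τ⁻¹ * (2 * b + 1 / τ) * (m ^ 2 + 2 * b + 3 / (2 * τ) + r ^ 2 / (4 * τ ^ 2)) ≤
      ((2 * b + 1) * (m ^ 2 + 2 * b + 2) * (1 + τ) ^ 2 * (1 + y) ^ 4) *
        ((r ^ 6)⁻¹ * (1 + (τ / r ^ 2) ^ 2)⁻¹) := by
    have e1 : (r ^ 6)⁻¹ * (1 + (τ / r ^ 2) ^ 2)⁻¹ = (τ ^ 3)⁻¹ * (y * (1 + y ^ 2))⁻¹ := by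
      rw [hr6, hr2]; field_simp; ring
    have e2 : τ⁻¹ * (2 * b + 1 / τ) * (m ^ 2 + 2 * b + 3 / (2 * τ) + r ^ 2 / (4 * τ ^ 2)) =
        ((2 * b * τ + 1) * ((m ^ 2 + 2 * b) * τ + 3 / 2 + y / 4) * (y * (1 + y ^ 2))) *
        ((τ ^ 3)⁻¹ * (y * (1 + y ^ 2))⁻¹) := by
      rw [hr2]; field_simp
    rw [e1, e2]
    gcongr ?_ * _
    have q1 : 2 * b * τ + 1 ≤ (2 * b + 1) * (1 + τ) := by nlinarith
    have q2 : (m ^ 2 + 2 * b) * τ + 3 / 2 + y / 4 ≤ (m ^ 2 + 2 * b + 2) * (1 + τ) * (1 + y) := by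
      have hM : 0 < m ^ 2 + 2 * b := by positivity
      generalize m ^ 2 + 2 * b = M at *
      have : 0 < M * τ := by positivity
      have : 0 < M * y := by positivity
      have : 0 < M * τ * y := by positivity
      have : 0 < τ * y := by positivity
      nlinarith
    have q3 : y * (1 + y ^ 2) ≤ (1 + y) ^ 3 := by nlinarith [pow_pos hy0 2, pow_pos hy0 3]
    calc _ ≤ ((2 * b + 1) * (1 + τ)) * ((m ^ 2 + 2 * b + 2) * (1 + τ) * (1 + y)) * (1 + y) ^ 3 := by
          gcongr
      _ = _ := by ring
  calc _ ≤ (((2 * b + 1) * (m ^ 2 + 2 * b + 2) * (1 + τ) ^ 2 * (1 + y) ^ 4) *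
        ((r ^ 6)⁻¹ * (1 + (τ / r ^ 2) ^ 2)⁻¹)) * (Real.exp (-(m - ε) * r) *
      (Real.exp (-(ε / m * m ^ 2 * τ)) * Real.exp (-(ε / m / 4 * y)))) := by gcongr
    _ = ((2 * b + 1) * (m ^ 2 + 2 * b + 2)) * ((1 + τ) ^ 2 * Real.exp (-(ε / m * m ^ 2 * τ))) *
        ((1 + y) ^ 4 * Real.exp (-(ε / m / 4 * y))) *
        ((r ^ 6)⁻¹ * (1 + (τ / r ^ 2) ^ 2)⁻¹ * Real.exp (-(m - ε) * r)) := by ring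
    _ ≤ ((2 * b + 1) * (m ^ 2 + 2 * b + 2)) * K1 * K2 *
        ((r ^ 6)⁻¹ * (1 + (τ / r ^ 2) ^ 2)⁻¹ * Real.exp (-(m - ε) * r)) := by gcongr
    _ = _ := by ring

/-- Let `m > 0`, `b > 0`, `s ∈ {-1, +1}` and `0 < ε < m`. Then there exists a constant
`C > 0` (depending on `m`, `b` and `ε`) such that
`|E_s(z)| ≤ C |z|⁻⁴ e^{-(m-ε)|z|}` for all `z ≠ 0`. -/
theorem kinKernel_bound_exp_decay (m b ε : ℝ) (hm : 0 < m) (hb : 0 < b)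
    (s : ℝ) (hs : s = -1 ∨ s = 1) (hε : 0 < ε) (hεm : ε < m) :
    ∃ C : ℝ, 0 < C ∧ ∀ z : EuclideanSpace ℝ (Fin 3), z ≠ 0 →
      |kinKernel m b s z| ≤ C / ‖z‖ ^ 4 * Real.exp (-(m - ε) * ‖z‖) := by
  obtain ⟨K, hK, hfin⟩ := aux_final m b ε hm hb hε hεm
  refine ⟨1 / Real.sqrt π * (K * π), by positivity, fun z hz => ?_⟩
  have hr : 0 < ‖z‖ := norm_pos_iff.2 hz
  have hr2 : ‖z‖ ^ 2 ≠ 0 := by positivity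
  have hint : Integrable (fun τ : ℝ => (1 + (τ / ‖z‖ ^ 2) ^ 2)⁻¹) :=
    integrable_inv_one_add_sq.comp_div hr2
  have hval : ∫ τ : ℝ, (1 + (τ / ‖z‖ ^ 2) ^ 2)⁻¹ = ‖z‖ ^ 2 * π := by
    rw [Measure.integral_comp_div (fun x : ℝ => (1 + x ^ 2)⁻¹), integral_univ_inv_one_add_sq,
      abs_of_pos (by positivity), smul_eq_mul]
  have hle : ∫ τ in Set.Ioi (0 : ℝ), (1 + (τ / ‖z‖ ^ 2) ^ 2)⁻¹ ≤ ‖z‖ ^ 2 * π := by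
    rw [← hval]
    exact setIntegral_le_integral hint (Filter.Eventually.of_forall fun τ => by positivity)
  have key := norm_integral_le_of_norm_le (μ := volume.restrict (Set.Ioi (0 : ℝ)))
    (f := fun τ : ℝ => τ ^ (-(1 : ℝ) / 2) *
      deriv (fun σ : ℝ => Real.exp (-σ * m ^ 2) * Real.exp (s * b * σ) * mehlerN b σ z) τ)
    (g := fun τ : ℝ => (K / ‖z‖ ^ 6 * Real.exp (-(m - ε) * ‖z‖)) * (1 + (τ / ‖z‖ ^ 2) ^ 2)⁻¹)
    (hint.integrableOn.const_mul _)
    ((ae_restrict_mem measurableSet_Ioi).mono fun τ hτ =>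
      (aux_bound m b s τ z hb hτ hs).trans (hfin τ ‖z‖ hτ hr))
  rw [integral_const_mul] at key
  unfold kinKernel
  rw [abs_mul, abs_neg, abs_of_nonneg (show 0 ≤ 1 / Real.sqrt π by positivity)]
  calc _ ≤ 1 / Real.sqrt π * ((K / ‖z‖ ^ 6 * Real.exp (-(m - ε) * ‖z‖)) * (‖z‖ ^ 2 * π)) := by
        refine mul_le_mul_of_nonneg_left (key.trans ?_) (by positivity)
        gcongr
    _ = _ := by field_simp
end

section
/- For all m > 0, b ≥ 0 and r > 0: (r/π³) · ∫₀^∞ ∫₀^∞ (t'τ)^{−1/2} e^{−mτ} (τ + t')^{−3} [ ∫₀^∞ e^{−σ} e^{−r²σ/(τ+t')²} e^{−(τ+t')²m²/(4σ)} ( 4σ²/(τ+t')² + 3bσ + (b²/2)(τ+t')² ) dσ ] dτ dt' ≤ (√2/π²) · [ m² K₂(mr)/r + (3/2) b m K₁(mr) + (b²/2) r K₀(mr) ]. -/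
open Real MeasureTheory

/-- The modified Bessel function of the second kind,
`K_ν(z) = ∫₀^∞ e^{-z cosh u} cosh(νu) du` for `z > 0`. -/
noncomputable def besselK (ν z : ℝ) : ℝ :=
  ∫ u in Set.Ioi (0 : ℝ), Real.exp (-z * Real.cosh u) * Real.cosh (ν * u)

section

open Set Filter Topology

lemma kdi_cosh_lower (u : ℝ) : u ^ 2 / 4 ≤ Real.cosh u := by
  rw [← Real.cosh_abs, Real.cosh_eq]
  have h := Real.quadratic_le_exp_of_nonneg (abs_nonneg u)
  have h2 := (Real.exp_pos (-|u|)).le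
  rw [sq_abs] at h
  have := abs_nonneg u
  linarith

lemma kdi_integrable (ν z : ℝ) (hz : 0 < z) :
    Integrable (fun u : ℝ => Real.exp (ν * u) * Real.exp (-z * Real.cosh u)) := by
  refine Integrable.mono' ((integrable_exp_neg_mul_sq (b := z / 8) (by positivity)).const_mul
    (Real.exp (2 * ν ^ 2 / z))) (by fun_prop) (ae_of_all _ fun u => ?_)
  rw [Real.norm_of_nonneg (by positivity), ← Real.exp_add, ← Real.exp_add]
  apply Real.exp_le_exp.mpr
  have h1 := mul_le_mul_of_nonneg_left (kdi_cosh_lower u) hz.le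
  have h2 : ν * u ≤ 2 * ν ^ 2 / z + z * u ^ 2 / 8 := by
    have : 2 * ν ^ 2 / z + z * u ^ 2 / 8 - ν * u = (4 * ν - z * u) ^ 2 / (8 * z) := by
      field_simp
      ring
    have h3 : 0 ≤ (4 * ν - z * u) ^ 2 / (8 * z) := by positivity
    linarith
  nlinarith

lemma kdi_integral (ν z : ℝ) (hz : 0 < z) :
    ∫ u : ℝ, Real.exp (ν * u) * Real.exp (-z * Real.cosh u) = 2 * besselK ν z := by
  have h1 : ∫ u : ℝ, Real.exp (ν * u) * Real.exp (-z * Real.cosh u)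
      = ∫ u : ℝ, Real.exp (-ν * u) * Real.exp (-z * Real.cosh u) := by
    rw [← integral_neg_eq_self]
    simp
  have h2 : (∫ u : ℝ, Real.exp (-z * Real.cosh u) * Real.cosh (ν * u)) = 2 * besselK ν z := by
    rw [besselK, ← integral_comp_abs]
    congr 1
    ext u
    rcases abs_choice u with h | h <;> simp [h]
  have h3 : (∫ u : ℝ, Real.exp (-z * Real.cosh u) * Real.cosh (ν * u))
      = (1 / 2) * ((∫ u : ℝ, Real.exp (ν * u) * Real.exp (-z * Real.cosh u)) +
        ∫ u : ℝ, Real.exp (-ν * u) * Real.exp (-z * Real.cosh u)) := by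
    rw [← integral_add (kdi_integrable ν z hz) (kdi_integrable (-ν) z hz),
      ← integral_const_mul]
    congr 1
    ext u
    rw [Real.cosh_eq (ν * u), neg_mul ν u]
    ring
  rw [← h1] at h3
  linarith

lemma kdi_scale (c : ℝ) (hc : 0 < c) (f : ℝ → ENNReal) :
    ∫⁻ x in Ioi (0 : ℝ), f x = ∫⁻ x in Ioi (0 : ℝ), ENNReal.ofReal c * f (c * x) := by
  have him : (fun x : ℝ => c * x) '' Ioi 0 = Ioi 0 := by
    rw [Set.image_mul_left_Ioi hc, mul_zero]
  have := lintegral_image_eq_lintegral_abs_deriv_mul (s := Ioi (0 : ℝ)) (f := fun x => c * x)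
    (f' := fun _ => c) measurableSet_Ioi
    (fun x _ => by simpa using ((hasDerivAt_id x).const_mul c).hasDerivWithinAt)
    (fun x _ y _ h => mul_left_cancel₀ hc.ne' h) f
  rw [him, abs_of_pos hc] at this
  exact this

lemma kdi_exp (c : ℝ) (hc : 0 < c) (f : ℝ → ENNReal) :
    ∫⁻ x in Ioi (0 : ℝ), f x
      = ∫⁻ u : ℝ, ENNReal.ofReal (c * Real.exp u) * f (c * Real.exp u) := by
  have him : (fun x : ℝ => c * Real.exp x) '' univ = Ioi 0 := by
    ext y
    simp only [image_univ, mem_range, mem_Ioi]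
    constructor
    · rintro ⟨x, rfl⟩
      positivity
    · intro hy
      refine ⟨Real.log (y / c), ?_⟩
      rw [Real.exp_log (by positivity)]
      field_simp
  have := lintegral_image_eq_lintegral_abs_deriv_mul (s := (univ : Set ℝ))
    (f := fun x => c * Real.exp x)
    (f' := fun x => c * Real.exp x) MeasurableSet.univ
    (fun x _ => ((Real.hasDerivAt_exp x).const_mul c).hasDerivWithinAt)
    (fun x _ y _ h => Real.exp_injective (mul_left_cancel₀ hc.ne' h)) f
  rw [him, Measure.restrict_univ] at this
  rw [this]
  congr 1
  ext x
  rw [abs_of_pos (by positivity)]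

lemma kdi_ftc (g g' : ℝ → ℝ) (l : ℝ) (hcont : ContinuousWithinAt g (Ici 0) 0)
    (hderiv : ∀ x ∈ Ioi (0 : ℝ), HasDerivAt g (g' x) x) (g'pos : ∀ x ∈ Ioi (0 : ℝ), 0 ≤ g' x)
    (hg : Tendsto g atTop (𝓝 l)) :
    ∫⁻ x in Ioi (0 : ℝ), ENNReal.ofReal (g' x) = ENNReal.ofReal (l - g 0) := by
  rw [← integral_Ioi_of_hasDerivAt_of_nonneg hcont hderiv g'pos hg,
    ofReal_integral_eq_lintegral_ofReal
      (integrableOn_Ioi_deriv_of_nonneg hcont hderiv g'pos hg)]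
  exact (ae_restrict_iff' measurableSet_Ioi).mpr (ae_of_all _ g'pos)

lemma kdi_gauss (a : ℝ) (ha : 0 < a) :
    ∫⁻ t in Ioi (0 : ℝ), ENNReal.ofReal (t * Real.exp (-a * t ^ 2))
      = ENNReal.ofReal (1 / (2 * a)) := by
  rw [kdi_ftc (fun t => -(Real.exp (-a * t ^ 2) / (2 * a))) _ 0]
  · simp
  · exact Continuous.continuousWithinAt (by fun_prop)
  · intro x _
    have h1 : HasDerivAt (fun t : ℝ => -a * t ^ 2) (-a * (2 * x)) x := by
      simpa using (hasDerivAt_pow 2 x).const_mul (-a)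
    refine (h1.exp.div_const (2 * a)).neg.congr_deriv ?_
    field_simp
    try ring
  · intro x hx
    have : 0 < x := hx
    positivity
  · have h : Tendsto (fun t : ℝ => -a * t ^ 2) atTop atBot :=
      (tendsto_pow_atTop two_ne_zero).const_mul_atTop_of_neg (by linarith)
    simpa using ((Real.tendsto_exp_atBot.comp h).div_const (2 * a)).neg

lemma kdi_arctan :
    ∫⁻ w in Ioi (0 : ℝ), ENNReal.ofReal (w ^ (-(1 : ℝ) / 2) * (1 + w)⁻¹)
      = ENNReal.ofReal π := by
  rw [kdi_ftc (fun w => 2 * Real.arctan (Real.sqrt w)) _ π]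
  · simp
  · exact Continuous.continuousWithinAt (by fun_prop)
  · intro x hx
    have hx : 0 < x := hx
    refine (((Real.hasDerivAt_sqrt hx.ne').arctan).const_mul 2).congr_deriv ?_
    rw [Real.sq_sqrt hx.le, neg_div, Real.rpow_neg hx.le, ← Real.sqrt_eq_rpow]
    have := Real.sqrt_pos.mpr hx
    field_simp
  · intro x hx
    have : 0 < x := hx
    positivity
  · have h := (Real.tendsto_arctan_atTop.mono_right nhdsWithin_le_nhds).comp
      Real.tendsto_sqrt_atTop
    have := h.const_mul 2
    simpa [mul_div_cancel₀] using this

/-- the Beta-type double integral -/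
lemma kdi_J (v : ℝ) (hv : 0 < v) :
    ∫⁻ t in Ioi (0 : ℝ), ∫⁻ τ in Ioi (0 : ℝ),
      ENNReal.ofReal ((t * τ) ^ (-(1 : ℝ) / 2) * ((τ + t) * Real.exp (-v * (τ + t) ^ 2)))
      = ENNReal.ofReal (π / (2 * v)) := by
  have h1 : ∀ t ∈ Ioi (0 : ℝ), ∫⁻ τ in Ioi (0 : ℝ),
      ENNReal.ofReal ((t * τ) ^ (-(1 : ℝ) / 2) * ((τ + t) * Real.exp (-v * (τ + t) ^ 2)))
      = ∫⁻ w in Ioi (0 : ℝ), ENNReal.ofReal (w ^ (-(1 : ℝ) / 2) * (1 + w)) *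
          ENNReal.ofReal (t * Real.exp (-(v * (1 + w) ^ 2) * t ^ 2)) := by
    intro t ht
    have ht : 0 < t := ht
    rw [kdi_scale t ht]
    refine setLIntegral_congr_fun measurableSet_Ioi fun w hw => ?_
    have hw : 0 < w := hw
    rw [← ENNReal.ofReal_mul ht.le, ← ENNReal.ofReal_mul (by positivity)]
    congr 1
    have e1 : (t * (t * w)) ^ (-(1 : ℝ) / 2) = t⁻¹ * w ^ (-(1 : ℝ) / 2) := by
      rw [← mul_assoc, Real.mul_rpow (by positivity) hw.le, ← pow_two, ← Real.rpow_natCast,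
        ← Real.rpow_mul ht.le]
      norm_num
      left
      rw [Real.rpow_neg_one]
    rw [e1]
    have e2 : -v * (t * w + t) ^ 2 = -(v * (1 + w) ^ 2) * t ^ 2 := by ring
    rw [e2]
    field_simp
    ring
  rw [setLIntegral_congr_fun measurableSet_Ioi h1, lintegral_lintegral_swap]
  · have h2 : ∀ w ∈ Ioi (0 : ℝ), ∫⁻ t in Ioi (0 : ℝ),
        ENNReal.ofReal (w ^ (-(1 : ℝ) / 2) * (1 + w)) *
          ENNReal.ofReal (t * Real.exp (-(v * (1 + w) ^ 2) * t ^ 2))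
        = ENNReal.ofReal (1 / (2 * v)) * ENNReal.ofReal (w ^ (-(1 : ℝ) / 2) * (1 + w)⁻¹) := by
      intro w hw
      have hw : 0 < w := hw
      rw [lintegral_const_mul' _ _ ENNReal.ofReal_ne_top, kdi_gauss _ (by positivity),
        ← ENNReal.ofReal_mul (by positivity), ← ENNReal.ofReal_mul (by positivity)]
      congr 1
      field_simp
    rw [setLIntegral_congr_fun measurableSet_Ioi h2,
      lintegral_const_mul' _ _ ENNReal.ofReal_ne_top, kdi_arctan,
      ← ENNReal.ofReal_mul (by positivity)]
    congr 1
    field_simp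
  · refine Measurable.aemeasurable ?_
    unfold Function.uncurry
    fun_prop

/-- the remaining one-dimensional integral -/
lemma kdi_V (m b r : ℝ) (hm : 0 < m) (hb : 0 ≤ b) (hr : 0 < r) :
    ∫⁻ v in Ioi (0 : ℝ), ENNReal.ofReal (Real.exp (-r ^ 2 * v - m ^ 2 / (4 * v)) *
        (4 * v ^ 2 + 3 * b * v + b ^ 2 / 2)) * ENNReal.ofReal (π / (2 * v))
      = ENNReal.ofReal (π / r * (m ^ 2 * besselK 2 (m * r) / r + 3 / 2 * b * m * besselK 1 (m * r) +
        b ^ 2 / 2 * r * besselK 0 (m * r))) := by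
  have hz : 0 < m * r := by positivity
  have hi := fun ν => kdi_integrable ν (m * r) hz
  have I2 := (hi 2).const_mul (π / 2 * (4 * (m / (2 * r)) ^ 2))
  have I1 := (hi 1).const_mul (π / 2 * (3 * b * (m / (2 * r))))
  have I0 := (hi 0).const_mul (π / 2 * (b ^ 2 / 2))
  rw [kdi_exp (m / (2 * r)) (by positivity)]
  have key : ∀ u : ℝ, ENNReal.ofReal (m / (2 * r) * Real.exp u) *
      (ENNReal.ofReal (Real.exp (-r ^ 2 * (m / (2 * r) * Real.exp u) -
          m ^ 2 / (4 * (m / (2 * r) * Real.exp u))) *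
        (4 * (m / (2 * r) * Real.exp u) ^ 2 + 3 * b * (m / (2 * r) * Real.exp u) + b ^ 2 / 2)) *
        ENNReal.ofReal (π / (2 * (m / (2 * r) * Real.exp u))))
      = ENNReal.ofReal (
        (π / 2 * (4 * (m / (2 * r)) ^ 2)) *
          (Real.exp (2 * u) * Real.exp (-(m * r) * Real.cosh u)) +
        (π / 2 * (3 * b * (m / (2 * r)))) *
          (Real.exp (1 * u) * Real.exp (-(m * r) * Real.cosh u)) +
        (π / 2 * (b ^ 2 / 2)) *
          (Real.exp (0 * u) * Real.exp (-(m * r) * Real.cosh u))) := by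
    intro u
    have hu := Real.exp_pos u
    rw [← ENNReal.ofReal_mul (by positivity), ← ENNReal.ofReal_mul (by positivity)]
    congr 1
    have e1 : -r ^ 2 * (m / (2 * r) * Real.exp u) - m ^ 2 / (4 * (m / (2 * r) * Real.exp u))
        = -(m * r) * Real.cosh u := by
      rw [Real.cosh_eq, Real.exp_neg]
      field_simp
      ring
    have e2 : Real.exp (2 * u) = Real.exp u ^ 2 := by
      rw [← Real.exp_nat_mul]
      norm_num
    rw [e1, e2, one_mul, zero_mul, Real.exp_zero]
    generalize Real.exp (-(m * r) * Real.cosh u) = E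
    field_simp
  simp_rw [key]
  refine (ofReal_integral_eq_lintegral_ofReal ((I2.fun_add I1).fun_add I0)
    (ae_of_all _ fun u => by dsimp only [Pi.zero_apply]; positivity)).symm.trans ?_
  congr 1
  rw [integral_add (I2.fun_add I1) I0, integral_add I2 I1, integral_const_mul, integral_const_mul,
    integral_const_mul, kdi_integral _ _ hz, kdi_integral _ _ hz, kdi_integral _ _ hz]
  field_simp
  ring

/-- substitution `σ = s² v` -/
lemma kdi_sigma (m b r s : ℝ) (hb : 0 ≤ b) (hs : 0 < s) :
    ‖∫ σ in Set.Ioi (0 : ℝ),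
            Real.exp (-σ) * Real.exp (-r ^ 2 * σ / s ^ 2) *
              Real.exp (-s ^ 2 * m ^ 2 / (4 * σ)) *
              (4 * σ ^ 2 / s ^ 2 + 3 * b * σ + b ^ 2 / 2 * s ^ 2)‖ₑ
    ≤ ENNReal.ofReal (s ^ 3) * ∫⁻ v in Ioi (0 : ℝ),
        ENNReal.ofReal (Real.exp (-r ^ 2 * v - m ^ 2 / (4 * v)) *
        (4 * v ^ 2 + 3 * b * v + b ^ 2 / 2)) * ENNReal.ofReal (s * Real.exp (-v * s ^ 2)) := by
  refine (enorm_integral_le_lintegral_enorm _).trans ?_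
  rw [kdi_scale (s ^ 2) (by positivity), ← lintegral_const_mul' _ _ ENNReal.ofReal_ne_top]
  refine le_of_eq (setLIntegral_congr_fun measurableSet_Ioi fun v hv => ?_)
  have hv : 0 < v := hv
  rw [Real.enorm_of_nonneg (by positivity), ← ENNReal.ofReal_mul (by positivity),
    ← ENNReal.ofReal_mul (by positivity), ← ENNReal.ofReal_mul (by positivity)]
  congr 1
  have e1 : Real.exp (-(s ^ 2 * v)) * Real.exp (-r ^ 2 * (s ^ 2 * v) / s ^ 2) *
      Real.exp (-s ^ 2 * m ^ 2 / (4 * (s ^ 2 * v)))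
      = Real.exp (-r ^ 2 * v - m ^ 2 / (4 * v)) * Real.exp (-v * s ^ 2) := by
    rw [← Real.exp_add, ← Real.exp_add, ← Real.exp_add]
    congr 1
    field_simp
    ring
  rw [e1]
  field_simp

lemma kdi_main (m b r : ℝ) (hm : 0 < m) (hb : 0 ≤ b) (hr : 0 < r) :
    ‖(∫ t' in Set.Ioi (0 : ℝ), ∫ τ in Set.Ioi (0 : ℝ),
        (t' * τ) ^ (-(1 : ℝ) / 2) * Real.exp (-m * τ) * ((τ + t') ^ 3)⁻¹ *
          ∫ σ in Set.Ioi (0 : ℝ),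
            Real.exp (-σ) * Real.exp (-r ^ 2 * σ / (τ + t') ^ 2) *
              Real.exp (-(τ + t') ^ 2 * m ^ 2 / (4 * σ)) *
              (4 * σ ^ 2 / (τ + t') ^ 2 + 3 * b * σ + b ^ 2 / 2 * (τ + t') ^ 2))‖ₑ ≤
    ENNReal.ofReal (π / r * (m ^ 2 * besselK 2 (m * r) / r + 3 / 2 * b * m * besselK 1 (m * r) +
        b ^ 2 / 2 * r * besselK 0 (m * r))) := by
  rw [← kdi_V m b r hm hb hr]
  set k : ℝ → ENNReal := fun v => ENNReal.ofReal (Real.exp (-r ^ 2 * v - m ^ 2 / (4 * v)) *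
        (4 * v ^ 2 + 3 * b * v + b ^ 2 / 2)) with hk
  have hkm : Measurable k := by fun_prop
  set q : ℝ → ℝ → ℝ → ENNReal := fun t τ v =>
    ENNReal.ofReal ((t * τ) ^ (-(1 : ℝ) / 2) * ((τ + t) * Real.exp (-v * (τ + t) ^ 2))) with hq
  have hqm : Measurable (fun p : ℝ × ℝ × ℝ => q p.1 p.2.1 p.2.2) := by fun_prop
  calc _ ≤ ∫⁻ t in Ioi (0 : ℝ), ∫⁻ τ in Ioi (0 : ℝ), ∫⁻ v in Ioi (0 : ℝ), k v * q t τ v := by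
        refine (enorm_integral_le_lintegral_enorm _).trans
          (setLIntegral_mono' measurableSet_Ioi fun t ht => ?_)
        refine (enorm_integral_le_lintegral_enorm _).trans
          (setLIntegral_mono' measurableSet_Ioi fun τ hτ => ?_)
        have ht : 0 < t := ht
        have hτ : 0 < τ := hτ
        rw [enorm_mul]
        refine (mul_le_mul_right (kdi_sigma m b r (τ + t) hb (by positivity)) _).trans ?_
        rw [← mul_assoc, Real.enorm_of_nonneg (by positivity),
          ← ENNReal.ofReal_mul (by positivity), ← lintegral_const_mul' _ _ ENNReal.ofReal_ne_top]
        refine setLIntegral_mono' measurableSet_Ioi fun v hv => ?_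
        have hv : 0 < v := hv
        rw [mul_left_comm]
        refine mul_le_mul_right ?_ _
        rw [← ENNReal.ofReal_mul (by positivity)]
        refine ENNReal.ofReal_le_ofReal ?_
        refine mul_le_mul_of_nonneg_right ?_ (by positivity)
        rw [mul_assoc, inv_mul_cancel₀ (by positivity), mul_one]
        refine mul_le_of_le_one_right (by positivity) ?_
        rw [Real.exp_le_one_iff]
        nlinarith
    _ = ∫⁻ t in Ioi (0 : ℝ), ∫⁻ v in Ioi (0 : ℝ), ∫⁻ τ in Ioi (0 : ℝ), k v * q t τ v := by
        refine lintegral_congr fun t => lintegral_lintegral_swap ?_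
        refine Measurable.aemeasurable ?_
        unfold Function.uncurry
        fun_prop
    _ = ∫⁻ v in Ioi (0 : ℝ), ∫⁻ t in Ioi (0 : ℝ), ∫⁻ τ in Ioi (0 : ℝ), k v * q t τ v := by
        refine lintegral_lintegral_swap ?_
        refine Measurable.aemeasurable ?_
        unfold Function.uncurry
        refine Measurable.lintegral_prod_right' (f := fun p : (ℝ × ℝ) × ℝ =>
          k p.1.2 * q p.1.1 p.2 p.1.2) ?_
        fun_prop
    _ ≤ _ := by
        refine le_of_eq (setLIntegral_congr_fun measurableSet_Ioi fun v hv => ?_)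
        beta_reduce
        simp_rw [lintegral_const_mul' (k v) _ ENNReal.ofReal_ne_top]
        rw [hq, kdi_J v hv]

lemma kdi_besselK_nonneg (ν z : ℝ) : 0 ≤ besselK ν z :=
  integral_nonneg fun u => mul_nonneg (Real.exp_pos _).le (Real.cosh_pos _).le

end

/-- For all `m > 0`, `b ≥ 0` and `r > 0`:
`(r/π³) ∫₀^∞ ∫₀^∞ (t'τ)^{-1/2} e^{-mτ} (τ+t')^{-3}
   [∫₀^∞ e^{-σ} e^{-r²σ/(τ+t')²} e^{-(τ+t')²m²/(4σ)}
     (4σ²/(τ+t')² + 3bσ + (b²/2)(τ+t')²) dσ] dτ dt'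
 ≤ (√2/π²) [m² K₂(mr)/r + (3/2) b m K₁(mr) + (b²/2) r K₀(mr)]`. -/
theorem kernel_double_integral_le_besselK (m b r : ℝ) (hm : 0 < m) (hb : 0 ≤ b)
    (hr : 0 < r) :
    r / π ^ 3 *
      (∫ t' in Set.Ioi (0 : ℝ), ∫ τ in Set.Ioi (0 : ℝ),
        (t' * τ) ^ (-(1 : ℝ) / 2) * Real.exp (-m * τ) * ((τ + t') ^ 3)⁻¹ *
          ∫ σ in Set.Ioi (0 : ℝ),
            Real.exp (-σ) * Real.exp (-r ^ 2 * σ / (τ + t') ^ 2) *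
              Real.exp (-(τ + t') ^ 2 * m ^ 2 / (4 * σ)) *
              (4 * σ ^ 2 / (τ + t') ^ 2 + 3 * b * σ + b ^ 2 / 2 * (τ + t') ^ 2)) ≤
    Real.sqrt 2 / π ^ 2 *
      (m ^ 2 * besselK 2 (m * r) / r + 3 / 2 * b * m * besselK 1 (m * r) +
        b ^ 2 / 2 * r * besselK 0 (m * r)) := by
  set B := m ^ 2 * besselK 2 (m * r) / r + 3 / 2 * b * m * besselK 1 (m * r) +
        b ^ 2 / 2 * r * besselK 0 (m * r) with hB
  have hB0 : 0 ≤ B := by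
    have h0 := kdi_besselK_nonneg 0 (m * r)
    have h1 := kdi_besselK_nonneg 1 (m * r)
    have h2 := kdi_besselK_nonneg 2 (m * r)
    positivity
  have h := kdi_main m b r hm hb hr
  rw [← hB, ← ofReal_norm, ENNReal.ofReal_le_ofReal_iff (by positivity)] at h
  have h' := (le_abs_self _).trans h
  refine (mul_le_mul_of_nonneg_left h' (by positivity)).trans ?_
  have e : r / π ^ 3 * (π / r * B) = 1 / π ^ 2 * B := by
    field_simp
  rw [e]
  have hs : (1 : ℝ) ≤ Real.sqrt 2 := by
    rw [Real.one_le_sqrt]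
    norm_num
  gcongr
end
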